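/- The set {x_1^{r_1}⋯x_n^{r_n} τ_ω : ω ∈ S_n, r_1,…,r_n ≥ 0} is a K-basis of R_n. Consequently (via the anti-automorphism of R_n fixing each x_k and each τ_k) the set {τ_ω x_1^{r_1}⋯x_n^{r_n} : ω ∈ S_n, r_1,…,r_n ≥ 0} is also a K-basis of R_n. -/

import Mathlib

namespace QH1

/-- Generators of the algebra `Rₙ` attached to a single imaginary index:
dots `x k` and crossings `t k`. -/
inductive Gen (n : ℕ) : Type
  | x (k : Fin n)
  | t (k : Fin (n - 1))

/-- Position `k` viewed in `Fin n`. -/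
def pc {n : ℕ} (k : Fin (n - 1)) : Fin n := ⟨k.1, by have := k.2; omega⟩

/-- Position `k+1` viewed in `Fin n`. -/
def ps {n : ℕ} (k : Fin (n - 1)) : Fin n := ⟨k.1 + 1, by have := k.2; omega⟩

variable (K : Type) [Field K]

/-- The free algebra on the generators. -/
abbrev F (n : ℕ) : Type := FreeAlgebra K (Gen n)

def gx {n : ℕ} (k : Fin n) : F K n := FreeAlgebra.ι K (Gen.x k)
def gt {n : ℕ} (k : Fin (n - 1)) : F K n := FreeAlgebra.ι K (Gen.t k)

/-- The defining relations of `Rₙ` (single imaginary index in `I⁻`). -/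
inductive Rel (n : ℕ) : F K n → F K n → Prop
  | xx (k t : Fin n) : Rel n (gx K k * gx K t) (gx K t * gx K k)
  | tsq (k : Fin (n - 1)) : Rel n (gt K k * gt K k) 0
  | braid (k k' : Fin (n - 1)) (h : k'.1 = k.1 + 1) :
      Rel n (gt K k * gt K k' * gt K k) (gt K k' * gt K k * gt K k')
  | ttfar (k t : Fin (n - 1)) (h : k.1 + 1 < t.1 ∨ t.1 + 1 < k.1) :
      Rel n (gt K k * gt K t) (gt K t * gt K k)
  | xt (k : Fin (n - 1)) : Rel n (gx K (pc k) * gt K k) (gt K k * gx K (ps k))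
  | tx (k : Fin (n - 1)) : Rel n (gt K k * gx K (pc k)) (gx K (ps k) * gt K k)
  | txfar (k : Fin (n - 1)) (t : Fin n) (h1 : t ≠ pc k) (h2 : t ≠ ps k) :
      Rel n (gt K k * gx K t) (gx K t * gt K k)

/-- The algebra `Rₙ = R(n·i)` for a single imaginary index `i ∈ I⁻`. -/
abbrev Rn (n : ℕ) : Type := RingQuot (Rel K n)

/-- The dot generators of `Rₙ`. -/
def X {n : ℕ} (k : Fin n) : Rn K n := RingQuot.mkAlgHom K (Rel K n) (gx K k)

/-- The crossing generators of `Rₙ`. -/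
def T {n : ℕ} (k : Fin (n - 1)) : Rn K n := RingQuot.mkAlgHom K (Rel K n) (gt K k)

/-- The simple transposition `s_k` of `{1, …, n}`. -/
def sPerm {n : ℕ} (k : Fin (n - 1)) : Equiv.Perm (Fin n) := Equiv.swap (pc k) (ps k)

/-- `l` is a reduced word for the permutation `ω`. -/
def IsRedWord {n : ℕ} (ω : Equiv.Perm (Fin n)) (l : List (Fin (n - 1))) : Prop :=
  (l.map sPerm).prod = ω ∧ ∀ l' : List (Fin (n - 1)), (l'.map sPerm).prod = ω → l.length ≤ l'.length

/-- `τ_ω`: the product of crossings along a word. -/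
def tprod {n : ℕ} (l : List (Fin (n - 1))) : Rn K n := (l.map (T K)).prod

end QH1

namespace QH1
section comb
variable {n : ℕ}

theorem pc_lt_ps (k : Fin (n - 1)) : pc k < ps k := by
  simp [pc, ps, Fin.lt_def]

theorem pc_ne_ps (k : Fin (n - 1)) : pc k ≠ ps k := (pc_lt_ps k).ne

theorem sPerm_pc (k : Fin (n - 1)) : sPerm k (pc k) = ps k := by simp [sPerm]
theorem sPerm_ps (k : Fin (n - 1)) : sPerm k (ps k) = pc k := by simp [sPerm]
theorem sPerm_sPerm (k : Fin (n - 1)) (a : Fin n) : sPerm k (sPerm k a) = a := by simp [sPerm]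
theorem sPerm_of_ne (k : Fin (n - 1)) {a : Fin n} (h1 : a ≠ pc k) (h2 : a ≠ ps k) :
    sPerm k a = a := Equiv.swap_apply_of_ne_of_ne h1 h2
theorem sPerm_inv (k : Fin (n - 1)) : (sPerm k)⁻¹ = sPerm k := by simp [sPerm]
theorem sPerm_mul_self (k : Fin (n - 1)) : sPerm k * sPerm k = 1 := by simp [sPerm]
theorem sPerm_mul_cancel (k : Fin (n - 1)) (w : Equiv.Perm (Fin n)) :
    sPerm k * (sPerm k * w) = w := by rw [← mul_assoc, sPerm_mul_self, one_mul]

theorem sPerm_lt (k : Fin (n - 1)) {a b : Fin n} (h : a < b) (h' : ¬ (a = pc k ∧ b = ps k)) :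
    sPerm k a < sPerm k b := by
  unfold sPerm
  rw [Equiv.swap_apply_def, Equiv.swap_apply_def]
  simp only [pc, ps, Fin.ext_iff, Fin.lt_def] at *
  split_ifs <;> (try simp only []) <;> omega

/-- left descents -/
def Des (k : Fin (n - 1)) (w : Equiv.Perm (Fin n)) : Prop := w⁻¹ (ps k) < w⁻¹ (pc k)

instance (k : Fin (n - 1)) (w : Equiv.Perm (Fin n)) : Decidable (Des k w) :=
  inferInstanceAs (Decidable (_ < _))

/-- inversions -/
def invSet (w : Equiv.Perm (Fin n)) : Finset (Fin n × Fin n) :=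
  Finset.univ.filter fun p => p.1 < p.2 ∧ w⁻¹ p.2 < w⁻¹ p.1

def len (w : Equiv.Perm (Fin n)) : ℕ := (invSet w).card

theorem mul_inv_app (k : Fin (n - 1)) (w : Equiv.Perm (Fin n)) (a : Fin n) :
    (sPerm k * w)⁻¹ a = w⁻¹ (sPerm k a) := by
  rw [mul_inv_rev, sPerm_inv]; rfl

theorem des_mul_iff (k : Fin (n - 1)) (w : Equiv.Perm (Fin n)) :
    Des k (sPerm k * w) ↔ ¬ Des k w := by
  unfold Des
  rw [mul_inv_app, mul_inv_app, sPerm_pc, sPerm_ps, not_lt]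
  refine ⟨le_of_lt, fun h => lt_of_le_of_ne h fun e => pc_ne_ps k (w⁻¹.injective e)⟩

theorem len_asc (k : Fin (n - 1)) (w : Equiv.Perm (Fin n)) (h : ¬ Des k w) :
    len (sPerm k * w) = len w + 1 := by
  have : invSet (sPerm k * w) = insert (pc k, ps k)
      ((invSet w).map ((sPerm k).prodCongr (sPerm k)).toEmbedding) := by
    ext ⟨a, b⟩
    have hd := (des_mul_iff k w).2 h
    simp only [invSet, Finset.mem_filter, Finset.mem_univ, true_and, Finset.mem_insert,
      Finset.mem_map, Equiv.coe_toEmbedding, Prod.exists, Equiv.prodCongr_apply, Prod.map_apply,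
      Prod.mk.injEq, mul_inv_app]
    constructor
    · rintro ⟨h1, h2⟩
      by_cases hab : a = pc k ∧ b = ps k
      · exact Or.inl hab
      · exact Or.inr ⟨sPerm k a, sPerm k b, ⟨sPerm_lt k h1 hab, h2⟩, sPerm_sPerm _ _,
          sPerm_sPerm _ _⟩
    · rintro (⟨rfl, rfl⟩ | ⟨c, d, ⟨h1, h2⟩, rfl, rfl⟩)
      · refine ⟨pc_lt_ps k, ?_⟩
        unfold Des at hd
        simpa only [mul_inv_app] using hd
      · simp only [sPerm_sPerm]
        refine ⟨sPerm_lt k h1 ?_, h2⟩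
        rintro ⟨rfl, rfl⟩
        exact h h2
  unfold len
  rw [this, Finset.card_insert_of_notMem, Finset.card_map]
  simp only [invSet, Finset.mem_filter, Finset.mem_univ, true_and,
      Finset.mem_map, Equiv.coe_toEmbedding, Prod.exists, Equiv.prodCongr_apply, Prod.map_apply,
      Prod.mk.injEq]
  rintro ⟨c, d, ⟨h1, h2⟩, h3, h4⟩
  have e1 : c = ps k := by rw [← sPerm_sPerm k c, h3, sPerm_pc]
  have e2 : d = pc k := by rw [← sPerm_sPerm k d, h4, sPerm_ps]
  rw [e1, e2] at h1
  exact absurd h1 (pc_lt_ps k).not_gt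

theorem len_des (k : Fin (n - 1)) (w : Equiv.Perm (Fin n)) (h : Des k w) :
    len w = len (sPerm k * w) + 1 := by
  have h' : ¬ Des k (sPerm k * w) := by rw [des_mul_iff]; exact not_not.2 h
  have := len_asc k _ h'
  rwa [sPerm_mul_cancel] at this

theorem eq_one_of_no_des (w : Equiv.Perm (Fin n)) (h : ∀ k, ¬ Des k w) : w = 1 := by
  have hm : StrictMono (w⁻¹ : Equiv.Perm (Fin n)) := by
    rcases n with _ | n
    · intro a; exact a.elim0
    · rw [Fin.strictMono_iff_lt_succ]
      intro i
      have := h i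
      unfold Des at this
      rw [not_lt] at this
      exact lt_of_le_of_ne this fun e => pc_ne_ps (n := n + 1) i (w⁻¹.injective e)
  have h1 : (w⁻¹ : Equiv.Perm (Fin n)) = 1 := by
    have := Subsingleton.elim (hm.orderIsoOfSurjective _ w⁻¹.surjective) (OrderIso.refl _)
    ext a
    have := congrArg (fun f => f a) this
    simpa using congrArg Fin.val this
  simpa using h1

theorem len_one : len (1 : Equiv.Perm (Fin n)) = 0 := by
  unfold len invSet
  rw [Finset.card_eq_zero, Finset.filter_eq_empty_iff]
  rintro ⟨a, b⟩ - ⟨h1, h2⟩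
  exact lt_asymm h1 (by simpa using h2)

/-- permutation of a word -/
def wp (l : List (Fin (n - 1))) : Equiv.Perm (Fin n) := (l.map sPerm).prod

theorem wp_cons (k : Fin (n - 1)) (l : List (Fin (n - 1))) : wp (k :: l) = sPerm k * wp l := by
  simp [wp]

theorem exists_word (w : Equiv.Perm (Fin n)) : ∃ l, wp l = w ∧ l.length = len w := by
  induction hN : len w generalizing w with
  | zero =>
    refine ⟨[], ?_, rfl⟩
    rw [eq_one_of_no_des w fun k hk => by have := len_des k w hk; omega]
    simp [wp]
  | succ N ih =>
    by_cases h : ∀ k, ¬ Des k w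
    · rw [eq_one_of_no_des w h, len_one] at hN; omega
    · push Not at h
      obtain ⟨k, hk⟩ := h
      obtain ⟨l, h1, h2⟩ := ih (sPerm k * w) (by have := len_des k w hk; omega)
      exact ⟨k :: l, by rw [wp_cons, h1, sPerm_mul_cancel], by simp [h2]⟩

theorem len_wp_le (l : List (Fin (n - 1))) : len (wp l) ≤ l.length := by
  induction l with
  | nil => simp [wp, len_one]
  | cons k l ih =>
    rw [wp_cons, List.length_cons]
    by_cases h : Des k (wp l)
    · have := len_des k _ h; omega
    · have := len_asc k _ h; omega

theorem IsRedWord.len_eq {w : Equiv.Perm (Fin n)} {l : List (Fin (n - 1))} (h : IsRedWord w l) :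
    l.length = len w := by
  obtain ⟨m, h1, h2⟩ := exists_word w
  have := h.2 m h1
  have h3 := len_wp_le l
  rw [show wp l = w from h.1] at h3
  omega

theorem red_cons {k : Fin (n - 1)} {l : List (Fin (n - 1))}
    (h : (k :: l).length = len (wp (k :: l))) :
    ¬ Des k (wp l) ∧ l.length = len (wp l) := by
  rw [wp_cons, List.length_cons] at h
  have h2 := len_wp_le l
  by_cases hd : Des k (wp l)
  · have := len_des k _ hd; omega
  · have := len_asc k _ hd; exact ⟨hd, by omega⟩

theorem red_cons_des {k : Fin (n - 1)} {l : List (Fin (n - 1))}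
    (h : (k :: l).length = len (wp (k :: l))) : Des k (wp (k :: l)) := by
  rw [wp_cons, des_mul_iff]; exact (red_cons h).1

theorem des_word {k : Fin (n - 1)} {w : Equiv.Perm (Fin n)} (h : Des k w) :
    ∃ l, wp (k :: l) = w ∧ (k :: l).length = len w := by
  obtain ⟨l, h1, h2⟩ := exists_word (sPerm k * w)
  refine ⟨l, by rw [wp_cons, h1, sPerm_mul_cancel], ?_⟩
  rw [len_des k w h, List.length_cons, h2]

theorem sPerm_far {k t : Fin (n - 1)} (h : k.1 + 1 < t.1 ∨ t.1 + 1 < k.1) :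
    sPerm k (pc t) = pc t ∧ sPerm k (ps t) = ps t := by
  constructor <;> apply sPerm_of_ne <;> simp only [pc, ps, ne_eq, Fin.ext_iff] <;> omega

theorem des_far {k t : Fin (n - 1)} (h : k.1 + 1 < t.1 ∨ t.1 + 1 < k.1) (w : Equiv.Perm (Fin n)) :
    Des t (sPerm k * w) ↔ Des t w := by
  unfold Des
  rw [mul_inv_app, mul_inv_app, (sPerm_far h).1, (sPerm_far h).2]

theorem comm_far {k t : Fin (n - 1)} (h : k.1 + 1 < t.1 ∨ t.1 + 1 < k.1) :
    sPerm k * sPerm t = sPerm t * sPerm k := by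
  ext a
  simp only [Equiv.Perm.mul_apply, sPerm, Equiv.swap_apply_def]
  simp only [pc, ps, Fin.ext_iff]
  split_ifs <;> simp only [] at * <;> omega

theorem braid_perm {k j : Fin (n - 1)} (h : j.1 = k.1 + 1) :
    sPerm k * (sPerm j * sPerm k) = sPerm j * (sPerm k * sPerm j) := by
  have e : pc j = ps k := by simp [pc, ps, h]
  have h1 : pc k ≠ ps k := pc_ne_ps k
  have h2 : pc k ≠ ps j := by simp only [pc, ps, ne_eq, Fin.ext_iff]; omega
  have h3 : ps j ≠ ps k := by simp only [ps, ne_eq, Fin.ext_iff]; omega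
  unfold sPerm
  rw [e, ← mul_assoc, ← mul_assoc, Equiv.swap_mul_swap_mul_swap h1 h2,
    Equiv.swap_comm (pc k) (ps k), Equiv.swap_comm (ps k) (ps j),
    Equiv.swap_mul_swap_mul_swap h3 h2.symm, Equiv.swap_comm]

theorem adj_vals {k j : Fin (n - 1)} (h : j.1 = k.1 + 1) :
    ps k = pc j ∧ sPerm k (ps j) = ps j ∧ sPerm j (pc k) = pc k := by
  refine ⟨by simp [pc, ps, h], ?_, ?_⟩ <;> apply sPerm_of_ne <;>
    simp only [pc, ps, ne_eq, Fin.ext_iff] <;> omega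

theorem des_adj1 {k j : Fin (n - 1)} (h : j.1 = k.1 + 1) (w : Equiv.Perm (Fin n)) :
    (Des j (sPerm k * w) ↔ w⁻¹ (ps j) < w⁻¹ (pc k)) ∧
    (Des k (sPerm j * (sPerm k * w)) ↔ Des j w) ∧
    (Des k (sPerm j * w) ↔ w⁻¹ (ps j) < w⁻¹ (pc k)) ∧
    (Des j (sPerm k * (sPerm j * w)) ↔ Des k w) := by
  obtain ⟨h1, h2, h3⟩ := adj_vals h
  have h4 := sPerm_ps k
  have h5 := sPerm_pc k
  rw [h1] at h4 h5
  unfold Des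
  simp only [mul_inv_app, h1, h2, h3, h4, h5, sPerm_pc, sPerm_ps, and_self, iff_self]

end comb
end QH1

namespace QH1
section alg
variable (K : Type) [Field K] {n : ℕ}

theorem X_comm (k t : Fin n) : X K k * X K t = X K t * X K k := by
  unfold X; rw [← map_mul, ← map_mul]; exact RingQuot.mkAlgHom_rel K (Rel.xx k t)
theorem T_sq (k : Fin (n - 1)) : T K k * T K k = 0 := by
  unfold T; rw [← map_mul, RingQuot.mkAlgHom_rel K (Rel.tsq k), map_zero]
theorem T_braid {k j : Fin (n - 1)} (h : j.1 = k.1 + 1) :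
    T K k * (T K j * T K k) = T K j * (T K k * T K j) := by
  unfold T; simp only [← map_mul, ← mul_assoc]; exact RingQuot.mkAlgHom_rel K (Rel.braid k j h)
theorem T_far {k t : Fin (n - 1)} (h : k.1 + 1 < t.1 ∨ t.1 + 1 < k.1) :
    T K k * T K t = T K t * T K k := by
  unfold T; simp only [← map_mul]; exact RingQuot.mkAlgHom_rel K (Rel.ttfar k t h)
theorem T_X (k : Fin (n - 1)) (a : Fin n) : T K k * X K a = X K (sPerm k a) * T K k := by
  by_cases h1 : a = pc k
  · subst h1
    rw [sPerm_pc]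
    unfold T X; simp only [← map_mul]; exact RingQuot.mkAlgHom_rel K (Rel.tx k)
  · by_cases h2 : a = ps k
    · subst h2
      rw [sPerm_ps]
      unfold T X; simp only [← map_mul]; exact (RingQuot.mkAlgHom_rel K (Rel.xt k)).symm
    · rw [sPerm_of_ne k h1 h2]
      unfold T X; simp only [← map_mul]; exact RingQuot.mkAlgHom_rel K (Rel.txfar k a h1 h2)

theorem exists_phi (n : ℕ) : ∃ φ : MvPolynomial (Fin n) K →ₐ[K] Rn K n,
    ∀ k, φ (MvPolynomial.X k) = X K k := by
  have hc : ∀ a ∈ Set.range (X K (n := n)), ∀ b ∈ Set.range (X K (n := n)), a * b = b * a := by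
    rintro _ ⟨k, rfl⟩ _ ⟨t, rfl⟩
    exact X_comm K k t
  let _ : CommRing (Algebra.adjoin K (Set.range (X K (n := n)))) :=
    Algebra.adjoinCommRingOfComm K hc
  refine ⟨(Algebra.adjoin K (Set.range (X K (n := n)))).val.comp
    (MvPolynomial.aeval fun k => ⟨X K k, Algebra.subset_adjoin ⟨k, rfl⟩⟩), fun k => ?_⟩
  simp

/-- the map from the polynomial ring -/
noncomputable def phi (n : ℕ) : MvPolynomial (Fin n) K →ₐ[K] Rn K n := (exists_phi K n).choose
theorem phi_X (k : Fin n) : phi K n (MvPolynomial.X k) = X K k := (exists_phi K n).choose_spec k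

theorem T_phi (k : Fin (n - 1)) (p : MvPolynomial (Fin n) K) :
    T K k * phi K n p = phi K n (MvPolynomial.rename (sPerm k) p) * T K k := by
  induction p using MvPolynomial.induction_on with
  | C a =>
    have : phi K n (MvPolynomial.C a) = algebraMap K _ a := (phi K n).commutes a
    rw [MvPolynomial.rename_C, this, Algebra.commutes]
  | add p q hp hq => simp only [map_add, mul_add, add_mul, hp, hq]
  | mul_X p i hp =>
    rw [map_mul, map_mul, map_mul, ← mul_assoc, hp, mul_assoc, phi_X, T_X, MvPolynomial.rename_X,
      phi_X, mul_assoc]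

theorem tprod_cons (k : Fin (n - 1)) (l : List (Fin (n - 1))) :
    tprod K (k :: l) = T K k * tprod K l := by simp [tprod]

theorem tprod_phi (l : List (Fin (n - 1))) (p : MvPolynomial (Fin n) K) :
    tprod K l * phi K n p = phi K n (MvPolynomial.rename (wp l) p) * tprod K l := by
  induction l with
  | nil =>
    have : (⇑(wp ([] : List (Fin (n - 1))))) = id := by simp [wp]
    simp [tprod, this]
  | cons k l ih =>
    rw [tprod_cons, mul_assoc, ih, ← mul_assoc, T_phi, MvPolynomial.rename_rename, wp_cons,
      mul_assoc]
    rfl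

/-- monomials -/
noncomputable def mon (r : Fin n → ℕ) : MvPolynomial (Fin n) K :=
  ∏ k, MvPolynomial.X k ^ r k

theorem phi_mon (r : Fin n → ℕ) :
    phi K n (mon K r) = (List.ofFn fun k : Fin n => X K k ^ r k).prod := by
  rw [mon, ← List.prod_ofFn, map_list_prod, List.map_ofFn]
  congr 2
  funext k
  simp [phi_X]

theorem rename_mon (w : Equiv.Perm (Fin n)) (r : Fin n → ℕ) :
    MvPolynomial.rename w (mon K r) = mon K (fun k => r (w⁻¹ k)) := by
  unfold mon
  rw [map_prod, ← Equiv.prod_comp w (fun k => MvPolynomial.X k ^ r (w⁻¹ k))]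
  simp

theorem X_mul_mon (k : Fin n) (r : Fin n → ℕ) :
    MvPolynomial.X k * mon K r = mon K (r + Pi.single k 1) := by
  unfold mon
  simp only [Pi.add_apply, pow_add, Finset.prod_mul_distrib]
  rw [mul_comm]
  congr 1
  rw [Finset.prod_eq_single k]
  · simp
  · intro b _ hb; simp [hb]
  · simp

theorem mon_eq (r : Fin n → ℕ) :
    mon K r = MvPolynomial.basisMonomials (Fin n) K (Finsupp.equivFunOnFinite.symm r) := by
  rw [MvPolynomial.coe_basisMonomials]
  dsimp only
  rw [MvPolynomial.monomial_eq, mon]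
  simp [Finsupp.prod_fintype]

/-- Matsumoto -/
theorem matsumoto (l m : List (Fin (n - 1))) (h : wp l = wp m)
    (hl : l.length = len (wp l)) (hm : m.length = len (wp m)) : tprod K l = tprod K m := by
  induction hN : l.length using Nat.strong_induction_on generalizing l m with
  | _ N ih =>
  rcases l with _ | ⟨s, l⟩
  · rw [← h, ← hl] at hm
    rw [List.eq_nil_of_length_eq_zero hm]
  rcases m with _ | ⟨t, m⟩
  · rw [h, ← hm] at hl; simp at hl
  have hls := (red_cons hl).2
  have hms := (red_cons hm).2
  have ds := red_cons_des hl
  have dt := red_cons_des hm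
  have hlen : l.length = m.length := by
    rw [h, ← hm] at hl; simpa using hl
  rw [List.length_cons] at hN
  rw [← h] at dt
  have el : wp l = sPerm s * wp (s :: l) := by rw [wp_cons, sPerm_mul_cancel]
  have em : wp m = sPerm t * wp (s :: l) := by rw [h, wp_cons, sPerm_mul_cancel]
  by_cases hst : s = t
  · subst hst
    rw [tprod_cons, tprod_cons, ih l.length (by omega) l m (by rw [el, em]) hls hms rfl]
  -- adjacent case
  have adj : ∀ (k j : Fin (n - 1)) (l' m' : List (Fin (n - 1))), j.1 = k.1 + 1 →
      Des k (wp (s :: l)) → Des j (wp (s :: l)) →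
      wp l' = sPerm k * wp (s :: l) → wp m' = sPerm j * wp (s :: l) →
      l'.length = len (wp l') → m'.length = len (wp m') → l'.length < N → m'.length < N →
      tprod K (k :: l') = tprod K (j :: m') := by
    intro k j l' m' hkj dk dj e1 e2 r1 r2 n1 n2
    generalize wp (s :: l) = w at *
    obtain ⟨a1, a2, a3, a4⟩ := des_adj1 hkj w
    have hlt : w⁻¹ (ps j) < w⁻¹ (pc k) := by
      unfold Des at dk dj
      rw [(adj_vals hkj).1] at dk
      exact dj.trans dk
    have b1 := a1.2 hlt
    have b2 := a2.2 dj
    have b3 := a3.2 hlt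
    have b4 := a4.2 dk
    have c1 := len_des _ _ b1
    have c2 := len_des _ _ b2
    have c3 := len_des _ _ b3
    have c4 := len_des _ _ b4
    obtain ⟨u, u1, u2⟩ := exists_word (sPerm k * (sPerm j * (sPerm k * w)))
    have hb : sPerm k * (sPerm j * (sPerm k * w)) = sPerm j * (sPerm k * (sPerm j * w)) := by
      have := congrArg (· * w) (braid_perm hkj)
      simpa only [mul_assoc] using this
    have f1 : wp (j :: k :: u) = wp l' := by
      rw [wp_cons, wp_cons, u1, sPerm_mul_cancel, sPerm_mul_cancel, e1]
    have f2 : wp (k :: j :: u) = wp m' := by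
      rw [wp_cons, wp_cons, u1, hb, sPerm_mul_cancel, sPerm_mul_cancel, e2]
    rw [tprod_cons, tprod_cons,
      ih l'.length n1 l' (j :: k :: u) f1.symm r1
        (by rw [f1, e1, c1, c2, List.length_cons, List.length_cons, u2]) rfl,
      ih m'.length n2 m' (k :: j :: u) f2.symm r2
        (by rw [f2, e2, c3, c4, List.length_cons, List.length_cons, u2, hb]) rfl]
    simp only [tprod_cons]
    have := congrArg (· * tprod K u) (T_braid K hkj)
    simpa only [mul_assoc] using this
  by_cases h1 : t.1 = s.1 + 1
  · exact adj s t l m h1 ds dt el em hls hms (by omega) (by omega)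
  by_cases h2 : s.1 = t.1 + 1
  · exact (adj t s m l h2 dt ds em el hms hls (by omega) (by omega)).symm
  have hne : s.1 ≠ t.1 := fun e => hst (Fin.ext e)
  have far : s.1 + 1 < t.1 ∨ t.1 + 1 < s.1 := by omega
  have far' : t.1 + 1 < s.1 ∨ s.1 + 1 < t.1 := by omega
  have d1 := (des_far far (wp (s :: l))).2 dt
  have d2 := (des_far far' (wp (s :: l))).2 ds
  have c1 := len_des _ _ d1
  have c2 := len_des _ _ d2
  obtain ⟨u, u1, u2⟩ := exists_word (sPerm t * (sPerm s * wp (s :: l)))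
  have hb : sPerm t * (sPerm s * wp (s :: l)) = sPerm s * (sPerm t * wp (s :: l)) := by
    rw [← mul_assoc, ← mul_assoc, comm_far far]
  have f1 : wp (t :: u) = wp l := by
    rw [wp_cons, u1, sPerm_mul_cancel, el]
  have f2 : wp (s :: u) = wp m := by
    rw [wp_cons, u1, hb, sPerm_mul_cancel, em]
  rw [tprod_cons, tprod_cons,
    ih l.length (by omega) l (t :: u) f1.symm hls
      (by rw [f1, el, c1, List.length_cons, u2]) rfl,
    ih m.length (by omega) m (s :: u) f2.symm hms
      (by rw [f2, em, c2, List.length_cons, u2, hb]) rfl]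
  simp only [tprod_cons, ← mul_assoc, T_far K far]

theorem tprod_nonred (l : List (Fin (n - 1))) (h : l.length ≠ len (wp l)) : tprod K l = 0 := by
  induction l with
  | nil => simp [wp, len_one] at h
  | cons k l ih =>
    rw [tprod_cons]
    by_cases hl : l.length = len (wp l)
    · by_cases hd : Des k (wp l)
      · obtain ⟨m, h1, h2⟩ := des_word hd
        rw [matsumoto K l (k :: m) h1.symm hl (by rw [h1, h2]), tprod_cons, ← mul_assoc, T_sq,
          zero_mul]
      · have := len_asc k _ hd
        rw [wp_cons, List.length_cons] at h
        omega
    · rw [ih hl, mul_zero]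

/-! The polynomial representation. -/

abbrev Mod (n : ℕ) : Type := Equiv.Perm (Fin n) → MvPolynomial (Fin n) K

noncomputable def opX (k : Fin n) : Module.End K (Mod K n) where
  toFun f := fun w => MvPolynomial.X k * f w
  map_add' f g := by funext w; simp [mul_add]
  map_smul' c f := by funext w; simp

noncomputable def opT (k : Fin (n - 1)) : Module.End K (Mod K n) where
  toFun f := fun w => if Des k w then MvPolynomial.rename (sPerm k) (f (sPerm k * w)) else 0
  map_add' f g := by funext w; simp only [Pi.add_apply, map_add]; split_ifs <;> simp
  map_smul' c f := by funext w; simp only [Pi.smul_apply, map_smul]; split_ifs <;> simp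

theorem opX_apply (k : Fin n) (f : Mod K n) (w) : opX K k f w = MvPolynomial.X k * f w := rfl
theorem opT_apply (k : Fin (n - 1)) (f : Mod K n) (w) : opT K k f w =
    if Des k w then MvPolynomial.rename (sPerm k) (f (sPerm k * w)) else 0 := rfl

theorem opT_opX (k : Fin (n - 1)) (a : Fin n) :
    opT K k * opX K a = opX K (sPerm k a) * opT K k := by
  refine LinearMap.ext fun f => ?_
  funext w
  simp only [Module.End.mul_apply, opX_apply, opT_apply, map_mul, MvPolynomial.rename_X]
  split_ifs <;> simp

theorem rename_three {f g h f' g' h' : Equiv.Perm (Fin n)} (e : f * (g * h) = f' * (g' * h'))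
    (p : MvPolynomial (Fin n) K) :
    MvPolynomial.rename f (MvPolynomial.rename g (MvPolynomial.rename h p)) =
    MvPolynomial.rename f' (MvPolynomial.rename g' (MvPolynomial.rename h' p)) := by
  simp only [MvPolynomial.rename_rename]
  congr 2
  exact congrArg (fun e : Equiv.Perm (Fin n) => (e : Fin n → Fin n)) e

noncomputable def genOp : Gen n → Module.End K (Mod K n)
  | Gen.x k => opX K k
  | Gen.t k => opT K k

theorem rel_op ⦃x y : F K n⦄ (h : Rel K n x y) :
    FreeAlgebra.lift K (genOp K) x = FreeAlgebra.lift K (genOp K) y := by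
  cases h <;> simp only [map_mul, gx, gt, FreeAlgebra.lift_ι_apply, genOp, map_zero]
  case xx k t =>
    refine LinearMap.ext fun f => ?_
    funext w
    simp only [Module.End.mul_apply, opX_apply]
    ring
  case tsq k =>
    refine LinearMap.ext fun f => ?_
    funext w
    simp only [Module.End.mul_apply, opT_apply, des_mul_iff]
    split_ifs <;> simp
  case braid k j h =>
    refine LinearMap.ext fun f => ?_
    funext w
    obtain ⟨a1, a2, a3, a4⟩ := des_adj1 h w
    simp only [Module.End.mul_apply, opT_apply, a1, a2, a3, a4]
    have hb : sPerm k * (sPerm j * (sPerm k * w)) = sPerm j * (sPerm k * (sPerm j * w)) := by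
      have := congrArg (· * w) (braid_perm h)
      simpa only [mul_assoc] using this
    by_cases h1 : Des k w <;> by_cases h2 : Des j w <;>
      by_cases h3 : w⁻¹ (ps j) < w⁻¹ (pc k) <;> simp only [h1, h2, h3, if_true, if_false, map_zero]
    rw [hb, rename_three K (braid_perm h)]
  case ttfar k t h =>
    refine LinearMap.ext fun f => ?_
    funext w
    simp only [Module.End.mul_apply, opT_apply, des_far h, des_far h.symm]
    have hb : sPerm t * (sPerm k * w) = sPerm k * (sPerm t * w) := by
      rw [← mul_assoc, ← mul_assoc, comm_far h]
    have := rename_three K (f := 1) (f' := 1) (congrArg (1 * ·) (comm_far h))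
    simp only [Equiv.Perm.coe_one, MvPolynomial.rename_id, AlgHom.id_apply] at this
    by_cases h1 : Des k w <;> by_cases h2 : Des t w <;>
      simp only [h1, h2, if_true, if_false, map_zero]
    rw [hb, this]
  case xt k => rw [opT_opX, sPerm_ps]
  case tx k => rw [opT_opX, sPerm_pc]
  case txfar k t h1 h2 => rw [opT_opX, sPerm_of_ne k h1 h2]

noncomputable def rep (n : ℕ) : Rn K n →ₐ[K] Module.End K (Mod K n) :=
  RingQuot.liftAlgHom K ⟨FreeAlgebra.lift K (genOp K), rel_op K⟩

theorem rep_X (k : Fin n) : rep K n (X K k) = opX K k := by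
  unfold rep X gx
  rw [RingQuot.liftAlgHom_mkAlgHom_apply, FreeAlgebra.lift_ι_apply]; rfl
theorem rep_T (k : Fin (n - 1)) : rep K n (T K k) = opT K k := by
  unfold rep T gt
  rw [RingQuot.liftAlgHom_mkAlgHom_apply, FreeAlgebra.lift_ι_apply]; rfl

theorem rep_phi (p : MvPolynomial (Fin n) K) (f : Mod K n) (w) :
    rep K n (phi K n p) f w = p * f w := by
  induction p using MvPolynomial.induction_on generalizing f with
  | C a =>
    have : phi K n (MvPolynomial.C a) = algebraMap K _ a := (phi K n).commutes a
    rw [this, AlgHom.commutes, Module.algebraMap_end_apply, Pi.smul_apply, MvPolynomial.smul_eq_C_mul]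
  | add p q hp hq => simp only [map_add, LinearMap.add_apply, Pi.add_apply, add_mul, hp, hq]
  | mul_X p i hp =>
    rw [map_mul, map_mul, Module.End.mul_apply, hp, phi_X, rep_X, opX_apply, mul_assoc]

theorem rep_tprod (l : List (Fin (n - 1))) (h : l.length = len (wp l)) :
    rep K n (tprod K l) (Pi.single 1 1) = Pi.single (wp l) 1 := by
  induction l with
  | nil => simp [tprod, wp]
  | cons k l ih =>
    have hr := red_cons h
    rw [tprod_cons, map_mul, Module.End.mul_apply, ih hr.2, rep_T]
    funext w
    rw [opT_apply, wp_cons]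
    by_cases hw : w = sPerm k * wp l
    · subst hw
      rw [if_pos ((des_mul_iff _ _).2 hr.1), sPerm_mul_cancel]
      simp
    · have : sPerm k * w ≠ wp l := by
        rintro e; apply hw; rw [← e, sPerm_mul_cancel]
      rw [Pi.single_eq_of_ne this, Pi.single_eq_of_ne hw]
      simp

theorem first_li (red : Equiv.Perm (Fin n) → List (Fin (n - 1)))
    (hred : ∀ w, IsRedWord w (red w)) :
    LinearIndependent K (fun p : (Fin n → ℕ) × Equiv.Perm (Fin n) =>
      phi K n (mon K p.1) * tprod K (red p.2)) := by
  let ev : Rn K n →ₗ[K] Mod K n := (LinearMap.applyₗ (Pi.single 1 1)) ∘ₗ (rep K n).toLinearMap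
  apply LinearIndependent.of_comp ev
  have key := (Pi.basis (fun _ : Equiv.Perm (Fin n) =>
    MvPolynomial.basisMonomials (Fin n) K)).linearIndependent.comp
    (fun p : (Fin n → ℕ) × Equiv.Perm (Fin n) => ⟨p.2, Finsupp.equivFunOnFinite.symm p.1⟩) (by
      rintro ⟨a, b⟩ ⟨c, d⟩ h
      simp only [Sigma.mk.injEq, heq_eq_eq, EmbeddingLike.apply_eq_iff_eq] at h
      rw [h.1, h.2])
  refine Eq.subst (motive := fun v => LinearIndependent K v) (Eq.symm ?_) key
  funext ⟨r, w⟩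
  simp only [Function.comp_apply, Pi.basis_apply, ← mon_eq]
  have hw : wp (red w) = w := (hred w).1
  have h2 : (red w).length = len (wp (red w)) := by rw [hw]; exact (hred w).len_eq
  have e : ev (phi K n (mon K r) * tprod K (red w)) =
      rep K n (phi K n (mon K r) * tprod K (red w)) (Pi.single 1 1) := rfl
  rw [e, map_mul, Module.End.mul_apply, rep_tprod K _ h2, hw]
  funext v
  rw [rep_phi]
  by_cases hv : v = w
  · subst hv; simp
  · simp [Pi.single_eq_of_ne hv]

theorem first_span (red : Equiv.Perm (Fin n) → List (Fin (n - 1)))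
    (hred : ∀ w, IsRedWord w (red w)) :
    Submodule.span K (Set.range (fun p : (Fin n → ℕ) × Equiv.Perm (Fin n) =>
      phi K n (mon K p.1) * tprod K (red p.2))) = ⊤ := by
  set V := Submodule.span K (Set.range (fun p : (Fin n → ℕ) × Equiv.Perm (Fin n) =>
      phi K n (mon K p.1) * tprod K (red p.2))) with hV
  have hrl : ∀ w, (red w).length = len (wp (red w)) := fun w => by
    rw [show wp (red w) = w from (hred w).1]; exact (hred w).len_eq
  have hmem : ∀ r l, phi K n (mon K r) * tprod K l ∈ V := by
    intro r l
    by_cases h : l.length = len (wp l)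
    · rw [matsumoto K l (red (wp l)) (hred (wp l)).1.symm h (hrl _)]
      exact Submodule.subset_span ⟨(r, wp l), rfl⟩
    · rw [tprod_nonred K l h, mul_zero]; exact V.zero_mem
  have hone : (1 : Rn K n) ∈ V := by
    have := hmem 0 []
    simpa [mon, tprod] using this
  have hX : ∀ k, ∀ v ∈ V, X K k * v ∈ V := by
    intro k v hv
    induction hv using Submodule.span_induction with
    | mem v hv =>
      obtain ⟨⟨r, w⟩, rfl⟩ := hv
      dsimp only
      rw [← mul_assoc, ← phi_X, ← map_mul, X_mul_mon]
      exact hmem _ _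
    | zero => simp
    | add a b _ _ ha hb => rw [mul_add]; exact V.add_mem ha hb
    | smul c a _ ha => rw [mul_smul_comm]; exact V.smul_mem c ha
  have hT : ∀ k, ∀ v ∈ V, T K k * v ∈ V := by
    intro k v hv
    induction hv using Submodule.span_induction with
    | mem v hv =>
      obtain ⟨⟨r, w⟩, rfl⟩ := hv
      dsimp only
      rw [← mul_assoc, T_phi, rename_mon, mul_assoc, ← tprod_cons]
      exact hmem _ _
    | zero => simp
    | add a b _ _ ha hb => rw [mul_add]; exact V.add_mem ha hb
    | smul c a _ ha => rw [mul_smul_comm]; exact V.smul_mem c ha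
  have hall : ∀ a : F K n, ∀ v ∈ V, RingQuot.mkAlgHom K (Rel K n) a * v ∈ V := by
    intro a
    induction a using FreeAlgebra.induction with
    | grade0 c =>
      intro v hv
      rw [AlgHom.commutes, ← Algebra.smul_def]; exact V.smul_mem c hv
    | grade1 g =>
      rcases g with k | k
      · exact hX k
      · exact hT k
    | mul a b ha hb => intro v hv; rw [map_mul, mul_assoc]; exact ha _ (hb _ hv)
    | add a b ha hb => intro v hv; rw [map_add, add_mul]; exact V.add_mem (ha _ hv) (hb _ hv)
  rw [eq_top_iff]
  intro x _
  obtain ⟨a, rfl⟩ := RingQuot.mkAlgHom_surjective K (Rel K n) x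
  simpa using hall a 1 hone

/-- reindexing -/
def reidx (n : ℕ) : (Fin n → ℕ) × Equiv.Perm (Fin n) ≃ (Fin n → ℕ) × Equiv.Perm (Fin n) where
  toFun p := (fun k => p.1 (p.2⁻¹ k), p.2)
  invFun p := (fun k => p.1 (p.2 k), p.2)
  left_inv p := by simp
  right_inv p := by simp

theorem second_eq (red : Equiv.Perm (Fin n) → List (Fin (n - 1)))
    (hred : ∀ w, IsRedWord w (red w)) :
    (fun p : (Fin n → ℕ) × Equiv.Perm (Fin n) => tprod K (red p.2) * phi K n (mon K p.1)) =
    (fun p : (Fin n → ℕ) × Equiv.Perm (Fin n) =>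
      phi K n (mon K p.1) * tprod K (red p.2)) ∘ reidx n := by
  funext ⟨r, w⟩
  have hw : wp (red w) = w := (hred w).1
  simp only [Function.comp_apply, reidx, Equiv.coe_fn_mk]
  rw [tprod_phi, hw, rename_mon]

end alg
end QH1

open QH1 in
/-- `{x₁^{r₁}⋯xₙ^{rₙ} τ_ω}` is a `K`-basis of `Rₙ`, and likewise
`{τ_ω x₁^{r₁}⋯xₙ^{rₙ}}` is a `K`-basis of `Rₙ` (for any choice of reduced words). -/
theorem statement2 (K : Type) [Field K] [IsAlgClosed K] (n : ℕ) (hn : 1 ≤ n)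
    (r : ℕ) (hr : 0 < r) (a : ℤ) (ha : a ≤ 0) (ha2 : Even a)
    (red : Equiv.Perm (Fin n) → List (Fin (n - 1)))
    (hred : ∀ ω, IsRedWord ω (red ω)) :
    (LinearIndependent K
        (fun p : (Fin n → ℕ) × Equiv.Perm (Fin n) =>
          (List.ofFn fun k : Fin n => X K k ^ p.1 k).prod * tprod K (red p.2)) ∧
      Submodule.span K
          (Set.range (fun p : (Fin n → ℕ) × Equiv.Perm (Fin n) =>
            (List.ofFn fun k : Fin n => X K k ^ p.1 k).prod * tprod K (red p.2))) = ⊤) ∧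
    (LinearIndependent K
        (fun p : (Fin n → ℕ) × Equiv.Perm (Fin n) =>
          tprod K (red p.2) * (List.ofFn fun k : Fin n => X K k ^ p.1 k).prod) ∧
      Submodule.span K
          (Set.range (fun p : (Fin n → ℕ) × Equiv.Perm (Fin n) =>
            tprod K (red p.2) * (List.ofFn fun k : Fin n => X K k ^ p.1 k).prod)) = ⊤) := by
  simp only [← phi_mon]
  refine ⟨⟨first_li K red hred, first_span K red hred⟩, ?_⟩
  rw [second_eq K red hred]
  refine ⟨(first_li K red hred).comp _ (reidx n).injective, ?_⟩
  rw [(reidx n).surjective.range_comp]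
  exact first_span K red hred
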